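/- arXiv:2502.00690 — 6 statements merged into one kernel-verified Lean document; each statement's English description precedes it below -/
import Mathlib

section
/- For any submission-limit instance with exactly two authors (n = 2) such that both authors are non-compliant, i.e., |P₁| > x and |P₂| > x, there exists an ideal desk-rejection: a subset S of the papers such that each author aᵢ retains exactly x papers. -/
/-- Two finite sets with at least `x` elements each can be met in exactly `x` elements by a
common finite set. -/
theorem Finset.exists_card_inter_eq_and_card_inter_eq {α : Type*} [DecidableEq α]
    {A B : Finset α} {x : ℕ} (hA : x ≤ A.card) (hB : x ≤ B.card) :
    ∃ S : Finset α, (S ∩ A).card = x ∧ (S ∩ B).card = x := by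
  rcases le_total x (A ∩ B).card with h | h
  · obtain ⟨S, hS, hcard⟩ := Finset.exists_subset_card_eq h
    obtain ⟨hSA, hSB⟩ := Finset.subset_inter_iff.mp hS
    exact ⟨S, by rwa [Finset.inter_eq_left.mpr hSA], by rwa [Finset.inter_eq_left.mpr hSB]⟩
  · obtain ⟨S, hS, hSA, hScard⟩ :=
      Finset.exists_subsuperset_card_eq Finset.inter_subset_left h hA
    obtain ⟨T, hT, hTB, hTcard⟩ :=
      Finset.exists_subsuperset_card_eq Finset.inter_subset_right h hB
    have hUA : (S ∪ T) ∩ A = S := by grind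
    have hUB : (S ∪ T) ∩ B = T := by grind
    exact ⟨S ∪ T, by rw [hUA, hScard], by rw [hUB, hTcard]⟩

/-- For any submission-limit instance with exactly two authors, both of
whom are non-compliant (`x < |Pᵢ|` for each `i`), there is an ideal desk-rejection: a
subset `S` of the papers such that each author retains exactly `x` papers.
Authors are indexed by `Fin 2`, papers by `Fin m`, and `P i` is the set of papers
authored by author `i`. -/
theorem ideal_desk_rejection_two_noncompliant_authors
    (m x : ℕ) (hx : 0 < x) (P : Fin 2 → Finset (Fin m))
    (hnc : ∀ i : Fin 2, x < (P i).card) :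
    ∃ S : Finset (Fin m), ∀ i : Fin 2, (S ∩ P i).card = x := by
  obtain ⟨S, h₀, h₁⟩ :=
    Finset.exists_card_inter_eq_and_card_inter_eq (hnc 0).le (hnc 1).le
  exact ⟨S, Fin.forall_fin_two.mpr ⟨h₀, h₁⟩⟩
end

section
/- For any submission-limit instance with exactly two authors (n = 2) and any positive integer submission limit x, there exists an ideal desk-rejection, i.e., a subset S of the papers such that each author aᵢ retains exactly min(x, |Pᵢ|) papers. -/
/-- For any submission-limit instance with exactly two authors and any
positive submission limit `x`, there is an ideal desk-rejection: a subset `S` of the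
papers such that each author `i` retains exactly `min x |Pᵢ|` papers.
Authors are indexed by `Fin 2`, papers by `Fin m`, and `P i` is the set of papers
authored by author `i`. -/
theorem ideal_desk_rejection_two_authors
    (m x : ℕ) (hx : 0 < x) (P : Fin 2 → Finset (Fin m)) :
    ∃ S : Finset (Fin m), ∀ i : Fin 2, (S ∩ P i).card = min x (P i).card := by
  obtain ⟨T, hT, hTc⟩ := Finset.exists_subset_card_eq
    (s := P 0 ∩ P 1) (n := min x (P 0 ∩ P 1).card) (min_le_right _ _)
  have h0 := Finset.card_sdiff_add_card_inter (P 0) (P 1)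
  have h1 := Finset.card_sdiff_add_card_inter (P 1) (P 0)
  rw [Finset.inter_comm (P 1)] at h1
  obtain ⟨U, hU, hUc⟩ := Finset.exists_subset_card_eq
    (s := P 0 \ P 1) (n := min x (P 0).card - T.card) (by omega)
  obtain ⟨V, hV, hVc⟩ := Finset.exists_subset_card_eq
    (s := P 1 \ P 0) (n := min x (P 1).card - T.card) (by omega)
  have hS0 : (T ∪ U ∪ V) ∩ P 0 = T ∪ U := by grind
  have hS1 : (T ∪ U ∪ V) ∩ P 1 = T ∪ V := by grind
  have hTU : Disjoint T U := by
    rw [Finset.disjoint_left]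
    grind
  have hTV : Disjoint T V := by
    rw [Finset.disjoint_left]
    grind
  refine ⟨T ∪ U ∪ V, Fin.forall_fin_two.mpr ⟨?_, ?_⟩⟩
  · rw [hS0, Finset.card_union_of_disjoint hTU]
    omega
  · rw [hS1, Finset.card_union_of_disjoint hTV]
    omega
end

section
/- For every submission-limit instance with at most two authors (n ≤ 2) and any positive integer submission limit x, there exists an ideal desk-rejection: a subset S of the papers such that each author aᵢ retains exactly min(x, |Pᵢ|) papers. -/
/-- Any two finite sets can be truncated simultaneously to size at most `x` by a single set,
losing no more elements than necessary. -/
theorem Finset.exists_card_inter_eq_min {α : Type*} [DecidableEq α] (x : ℕ) (A B : Finset α) :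
    ∃ S : Finset α, (S ∩ A).card = min x A.card ∧ (S ∩ B).card = min x B.card := by
  have hA := Finset.card_sdiff_add_card_inter A B
  have hB := Finset.card_sdiff_add_card_inter B A
  rw [Finset.inter_comm B A] at hB
  obtain ⟨C, hC, hCcard⟩ := Finset.exists_subset_card_eq (min_le_right x (A ∩ B).card)
  obtain ⟨D, hD, hDcard⟩ := Finset.exists_subset_card_eq
    (show min x A.card - C.card ≤ (A \ B).card by omega)
  obtain ⟨E, hE, hEcard⟩ := Finset.exists_subset_card_eq
    (show min x B.card - C.card ≤ (B \ A).card by omega)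
  have hSA : (C ∪ D ∪ E) ∩ A = C ∪ D := by grind
  have hSB : (C ∪ D ∪ E) ∩ B = C ∪ E := by grind
  have hCD : Disjoint C D := by
    rw [Finset.disjoint_left]
    grind
  have hCE : Disjoint C E := by
    rw [Finset.disjoint_left]
    grind
  refine ⟨C ∪ D ∪ E, ?_, ?_⟩
  · rw [hSA, Finset.card_union_of_disjoint hCD]
    omega
  · rw [hSB, Finset.card_union_of_disjoint hCE]
    omega

/-- For every submission-limit instance with at most two authors
(`n ≤ 2`) and any positive submission limit `x`, there is an ideal desk-rejection: a
subset `S` of the papers such that each author `i` retains exactly `min x |Pᵢ|` papers.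
Authors are indexed by `Fin n`, papers by `Fin m`, and `P i` is the set of papers
authored by author `i`. -/
theorem ideal_desk_rejection_le_two_authors
    (n m x : ℕ) (hn : n ≤ 2) (hx : 0 < x) (P : Fin n → Finset (Fin m)) :
    ∃ S : Finset (Fin m), ∀ i : Fin n, (S ∩ P i).card = min x (P i).card := by
  interval_cases n
  · exact ⟨∅, fun i => i.elim0⟩
  · obtain ⟨S, hS, -⟩ := Finset.exists_card_inter_eq_min x (P 0) (P 0)
    exact ⟨S, fun i => by rwa [Subsingleton.elim i 0]⟩
  · obtain ⟨S, hS⟩ := Finset.exists_card_inter_eq_min x (P 0) (P 1)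
    exact ⟨S, Fin.forall_fin_two.2 hS⟩
end

section
/- Let n ≥ 3 and consider the submission-limit instance with n authors a₁,…,aₙ, n papers p₁,…,pₙ where paper pⱼ is authored exactly by all authors except aⱼ (so each author has |Pᵢ| = n − 1 papers), and submission limit x = n − 2. Then no subset S ⊆ 𝒫 is an ideal desk-rejection; that is, no S makes every author retain exactly n − 2 papers. -/
/-- Let `n ≥ 3`, and consider the instance with `n` authors and `n`
papers in which paper `j` is authored exactly by all authors except author `j`
(so author `i` authors the papers `univ \ {i}` and has `|Pᵢ| = n - 1` papers), with
submission limit `x = n - 2`. Then no subset `S` of the papers is an ideal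
desk-rejection, i.e. no `S` makes every author retain exactly `n - 2` papers. -/
theorem no_ideal_desk_rejection_complement_instance
    (n : ℕ) (hn : 3 ≤ n) (P : Fin n → Finset (Fin n))
    (hP : ∀ i : Fin n, P i = Finset.univ \ {i}) :
    ¬ ∃ S : Finset (Fin n), ∀ i : Fin n, (S ∩ P i).card = n - 2 := by
  rintro ⟨S, hS⟩
  have card_erase (i : Fin n) : (S.erase i).card = n - 2 := by
    rw [← hS i, hP i, Finset.sdiff_singleton_eq_erase, Finset.inter_erase, Finset.inter_univ]
  obtain ⟨i, hi⟩ : S.Nonempty := by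
    rw [Finset.nonempty_iff_ne_empty]
    rintro rfl
    have h := card_erase ⟨0, by omega⟩
    simp at h
    omega
  have card_S : S.card = n - 1 := by
    have h := Finset.card_erase_add_one hi
    rw [card_erase i] at h
    omega
  obtain ⟨j, hj⟩ : ∃ j, j ∉ S := by
    by_contra! h
    rw [Finset.eq_univ_iff_forall.mpr h, Finset.card_univ, Fintype.card_fin] at card_S
    omega
  have h := card_erase j
  rw [Finset.erase_eq_of_notMem hj] at h
  omega
end

section
/- For every integer n ≥ 3, there exists a submission-limit instance with exactly n authors (a choice of papers, authorship relation, and positive submission limit x) for which no subset S of the papers is an ideal desk-rejection. -/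
/-- Three papers forming a triangle cannot be retained so that each edge has exactly one. -/
lemma not_exists_inter_edge_card_eq_one :
    ¬ ∃ S : Finset (Fin 3), ∀ e : Fin 3, (S ∩ {e, e + 1}).card = 1 := by
  decide

/-- For every integer `n ≥ 3`, there exists a submission-limit instance
with exactly `n` authors — a number of papers `m`, an authorship relation
`P : Fin n → Finset (Fin m)`, and a positive submission limit `x` — for which no subset
`S` of the papers is an ideal desk-rejection (no `S` makes every author `i` retain
exactly `min x |Pᵢ|` papers). -/
theorem exists_instance_without_ideal_desk_rejection
    (n : ℕ) (hn : 3 ≤ n) :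
    ∃ (m x : ℕ) (P : Fin n → Finset (Fin m)), 0 < x ∧
      ¬ ∃ S : Finset (Fin m), ∀ i : Fin n, (S ∩ P i).card = min x (P i).card := by
  refine ⟨3, 1, fun i ↦ if h : (i : ℕ) < 3 then {⟨i, h⟩, ⟨i, h⟩ + 1} else ∅, one_pos, ?_⟩
  rintro ⟨S, hS⟩
  refine not_exists_inter_edge_card_eq_one ⟨S, fun e ↦ ?_⟩
  have hcard : min 1 ({e, e + 1} : Finset (Fin 3)).card = 1 :=
    min_eq_left (Finset.insert_nonempty _ _).card_pos
  simpa only [Fin.val_castLE, e.isLt, dite_true, Fin.eta, hcard] using hS (e.castLE hn)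
end

section
/- Consider the submission-limit instance with three authors, six papers, submission limit x = 2, where author a₁ authors p₁, p₂, p₃, p₄; author a₂ authors p₃, p₅; and author a₃ authors p₄, p₆. Then S = {p₃, p₄, p₅, p₆} satisfies the per-author limit with ζ_ind(S) = 1/2 and ζ_group(S) = 1/6, and every subset S' ⊆ 𝒫 satisfying the per-author limit has ζ_ind(S') ≥ 1/2 and ζ_group(S') ≥ 1/6. -/
/-- In the instance with three authors and six papers (indexed by
`Fin 6`, paper `pⱼ` being index `j - 1`), submission limit `x = 2`, where author `a₁`
authors `p₁, p₂, p₃, p₄` (`P 0 = {0,1,2,3}`), author `a₂` authors `p₃, p₅`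
(`P 1 = {2,4}`), and author `a₃` authors `p₄, p₆` (`P 2 = {3,5}`):
the set `S = {p₃, p₄, p₅, p₆} = {2,3,4,5}` satisfies the per-author limit with
`ζ_ind(S) = 1/2` and `ζ_group(S) = 1/6`, and every subset `S'` satisfying the
per-author limit has `ζ_ind(S') ≥ 1/2` and `ζ_group(S') ≥ 1/6`.
Here `c(aᵢ,S) = (|Pᵢ| − |S ∩ Pᵢ|)/|Pᵢ|`, `ζ_ind(S) = max_i c(aᵢ,S)`, and
`ζ_group(S) = (1/3)∑ᵢ c(aᵢ,S)`. -/
theorem three_author_case_study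
    (P : Fin 3 → Finset (Fin 6))
    (h0 : P 0 = {0, 1, 2, 3}) (h1 : P 1 = {2, 4}) (h2 : P 2 = {3, 5}) :
    ((∀ i : Fin 3, (({2, 3, 4, 5} : Finset (Fin 6)) ∩ P i).card ≤ 2) ∧
      (⨆ i : Fin 3, (((P i).card : ℝ)
          - ((({2, 3, 4, 5} : Finset (Fin 6)) ∩ P i).card : ℝ)) / ((P i).card : ℝ))
        = 1 / 2 ∧
      (1 / 3 : ℝ) * ∑ i : Fin 3, (((P i).card : ℝ)
          - ((({2, 3, 4, 5} : Finset (Fin 6)) ∩ P i).card : ℝ)) / ((P i).card : ℝ)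
        = 1 / 6)
    ∧ (∀ S' : Finset (Fin 6), (∀ i : Fin 3, (S' ∩ P i).card ≤ 2) →
      (1 / 2 : ℝ) ≤
        (⨆ i : Fin 3, (((P i).card : ℝ) - ((S' ∩ P i).card : ℝ)) / ((P i).card : ℝ)) ∧
      (1 / 6 : ℝ) ≤
        (1 / 3 : ℝ) * ∑ i : Fin 3,
          (((P i).card : ℝ) - ((S' ∩ P i).card : ℝ)) / ((P i).card : ℝ)) := by
  have c0 : (P 0).card = 4 := by rw [h0]; rfl
  have c1 : (P 1).card = 2 := by rw [h1]; rfl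
  have c2 : (P 2).card = 2 := by rw [h2]; rfl
  have s0 : (({2, 3, 4, 5} : Finset (Fin 6)) ∩ P 0).card = 2 := by rw [h0]; decide
  have s1 : (({2, 3, 4, 5} : Finset (Fin 6)) ∩ P 1).card = 2 := by rw [h1]; decide
  have s2 : (({2, 3, 4, 5} : Finset (Fin 6)) ∩ P 2).card = 2 := by rw [h2]; decide
  refine ⟨⟨?_, ?_, ?_⟩, fun S' hS => ?_⟩
  · rw [Fin.forall_fin_succ, Fin.forall_fin_two]
    exact ⟨s0.le, s1.le, s2.le⟩
  · apply le_antisymm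
    · refine ciSup_le fun i => ?_
      fin_cases i
      · simp only [Fin.zero_eta, c0, s0]; norm_num
      · simp only [Fin.mk_one, c1, s1]; norm_num
      · simp only [Fin.reduceFinMk, c2, s2]; norm_num
    · refine le_ciSup_of_le (Set.finite_range _).bddAbove 0 ?_
      rw [c0, s0]; norm_num
  · rw [Fin.sum_univ_three, c0, c1, c2, s0, s1, s2]; norm_num
  · have nonneg (i : Fin 3) :
        (0 : ℝ) ≤ (((P i).card : ℝ) - ((S' ∩ P i).card : ℝ)) / ((P i).card : ℝ) :=
      div_nonneg (sub_nonneg.2 (mod_cast Finset.card_le_card Finset.inter_subset_right))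
        (Nat.cast_nonneg _)
    have half :
        (1 / 2 : ℝ) ≤ (((P 0).card : ℝ) - ((S' ∩ P 0).card : ℝ)) / ((P 0).card : ℝ) := by
      have h : ((S' ∩ P 0).card : ℝ) ≤ 2 := mod_cast hS 0
      rw [c0]
      push_cast
      linarith
    refine ⟨le_ciSup_of_le (Set.finite_range _).bddAbove 0 half, ?_⟩
    rw [Fin.sum_univ_three]
    linarith [nonneg 1, nonneg 2]
end
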